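/- For any finite set of unit vectors x_1, …, x_N ∈ S^{n-1} and any k ≥ 0, the sum ∑_{i=1}^N ∑_{j=1}^N P_k^n(x_i · x_j) is nonnegative, where P_k^n is the Gegenbauer polynomial of degree k normalized with P_k^n(1) = 1. (Positive-definiteness of Gegenbauer polynomials / Schoenberg's theorem, finite form.) -/

import Mathlib

open scoped RealInnerProductSpace
open MeasureTheory Metric Polynomial

/-- The surface measure on the unit sphere of `ℝ^(m+2)`. -/
noncomputable abbrev surfaceMeasure (m : ℕ) :
    Measure (sphere (0 : EuclideanSpace ℝ (Fin (m + 2))) 1) :=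
  (volume : Measure (EuclideanSpace ℝ (Fin (m + 2)))).toSphere

theorem integrable_surfaceMeasure_of_continuous {m : ℕ}
    {f : sphere (0 : EuclideanSpace ℝ (Fin (m + 2))) 1 → ℝ} (hf : Continuous f) :
    Integrable f (surfaceMeasure m) :=
  hf.integrable_of_hasCompactSupport (HasCompactSupport.of_compactSpace f)

theorem integral_surfaceMeasure_comp_isometry {m : ℕ}
    (R : EuclideanSpace ℝ (Fin (m + 2)) ≃ₗᵢ[ℝ] EuclideanSpace ℝ (Fin (m + 2)))
    (G : EuclideanSpace ℝ (Fin (m + 2)) → ℝ) :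
    ∫ z, G (R z) ∂(surfaceMeasure m) = ∫ z, G z ∂(surfaceMeasure m) := by
  let T : sphere (0 : EuclideanSpace ℝ (Fin (m + 2))) 1 ≃ₜ
      sphere (0 : EuclideanSpace ℝ (Fin (m + 2))) 1 :=
    R.toHomeomorph.subtype fun z => by simp
  have hT : ∀ z, (T z : EuclideanSpace ℝ (Fin (m + 2))) = R z := fun z => rfl
  have hmp : MeasurePreserving T (surfaceMeasure m) (surfaceMeasure m) := by
    refine ⟨T.continuous.measurable, Measure.ext fun s hs => ?_⟩
    rw [Measure.map_apply T.continuous.measurable hs, Measure.toSphere_apply' _ hs,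
      Measure.toSphere_apply' _ (T.continuous.measurable hs)]
    congr 1
    symm
    rw [← (R.measurePreserving).measure_preimage_equiv (f := R.toMeasurableEquiv)]
    congr 1
    ext z
    simp only [Set.mem_smul, Set.mem_image, Set.mem_preimage,
      LinearIsometryEquiv.coe_toMeasurableEquiv]
    constructor
    · rintro ⟨r, hr, _, ⟨w, hw, rfl⟩, h⟩
      refine ⟨r, hr, _, ⟨T.symm w, by simpa using hw, rfl⟩, R.injective ?_⟩
      rw [map_smul, ← hT, T.apply_symm_apply, h]
    · rintro ⟨r, hr, _, ⟨w, hw, rfl⟩, rfl⟩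
      exact ⟨r, hr, _, ⟨T w, hw, rfl⟩, by simp [hT]⟩
  simpa only [hT] using hmp.integral_comp T.measurableEmbedding fun z => G z

/-- An orthonormal basis starting with `x` whose first two vectors span a plane containing `y`. -/
theorem exists_orthonormalBasis_adapted {m : ℕ} {x y : EuclideanSpace ℝ (Fin (m + 2))}
    (hx : ‖x‖ = 1) (hy : ‖y‖ = 1) :
    ∃ (b : OrthonormalBasis (Fin (m + 2)) ℝ (EuclideanSpace ℝ (Fin (m + 2)))) (s : ℝ),
      b 0 = x ∧ s ^ 2 = 1 - ⟪x, y⟫ ^ 2 ∧ y = ⟪x, y⟫ • x + s • b 1 := by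
  have hd : Module.finrank ℝ (EuclideanSpace ℝ (Fin (m + 2))) = Fintype.card (Fin (m + 2)) := by
    simp
  let f : Fin (m + 2) → EuclideanSpace ℝ (Fin (m + 2)) := fun i => if i = 0 then x else y
  let b := InnerProductSpace.gramSchmidtOrthonormalBasis hd f
  have h0 : InnerProductSpace.gramSchmidtNormed ℝ f 0 = x := by
    have : InnerProductSpace.gramSchmidt ℝ f 0 = x := InnerProductSpace.gramSchmidt_bot ℝ f
    simp [InnerProductSpace.gramSchmidtNormed, this, hx]
  have hb0 : b 0 = x := by
    rw [← h0]
    refine InnerProductSpace.gramSchmidtOrthonormalBasis_apply hd ?_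
    rw [h0]
    rintro rfl
    simp at hx
  have hb : ∀ i : Fin m, ⟪b i.succ.succ, y⟫ = 0 := fun i => by
    simpa [f] using InnerProductSpace.gramSchmidtOrthonormalBasis_inv_triangular hd f
      (i := 1) (j := i.succ.succ) (by rw [Fin.lt_def]; simp)
  have hsum : y = ⟪x, y⟫ • x + ⟪b 1, y⟫ • b 1 := by
    conv_lhs => rw [← b.sum_repr' y, Fin.sum_univ_succ, Fin.sum_univ_succ]
    simp [hb, hb0]
  refine ⟨b, ⟪b 1, y⟫, hb0, ?_, hsum⟩
  have := b.sum_sq_norm_inner_right y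
  rw [Fin.sum_univ_succ, Fin.sum_univ_succ] at this
  simp [hb, hb0, hy] at this
  linarith

theorem integral_surfaceMeasure_orthonormalBasis {m : ℕ}
    (b : OrthonormalBasis (Fin (m + 2)) ℝ (EuclideanSpace ℝ (Fin (m + 2)))) (G : ℝ → ℝ → ℝ) :
    ∫ z, G ⟪b 0, (z : EuclideanSpace ℝ (Fin (m + 2)))⟫ ⟪b 1, (z : EuclideanSpace ℝ (Fin (m + 2)))⟫
      ∂(surfaceMeasure m) =
    ∫ z, G (z.1 0) (z.1 1) ∂(surfaceMeasure m) := by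
  rw [← integral_surfaceMeasure_comp_isometry b.repr (fun z => G (z 0) (z 1))]
  simp only [OrthonormalBasis.repr_apply_apply]

theorem integral_surfaceMeasure_inner {m : ℕ} {x : EuclideanSpace ℝ (Fin (m + 2))} (hx : ‖x‖ = 1)
    (g : ℝ → ℝ) :
    ∫ z, g ⟪x, (z : EuclideanSpace ℝ (Fin (m + 2)))⟫ ∂(surfaceMeasure m) =
    ∫ z, g (z.1 0) ∂(surfaceMeasure m) := by
  obtain ⟨b, -, rfl, -⟩ := exists_orthonormalBasis_adapted hx hx
  exact integral_surfaceMeasure_orthonormalBasis b fun s _ => g s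

theorem integral_surfaceMeasure_odd {m : ℕ} (g : ℝ → ℝ) {l : ℕ} (hl : Odd l) :
    ∫ z, g (z.1 0) * (z.1 1) ^ l ∂(surfaceMeasure m) = 0 := by
  have h := integral_surfaceMeasure_comp_isometry
    (LinearIsometryEquiv.piLpCongrRight 2 fun i : Fin (m + 2) =>
      if i = 1 then LinearIsometryEquiv.neg ℝ (E := ℝ) else LinearIsometryEquiv.refl ℝ ℝ)
    (fun z => g (z 0) * (z 1) ^ l)
  simp [hl.neg_pow, integral_neg] at h
  linarith

theorem integral_surfaceMeasure_coord_pow_odd {m : ℕ} {l : ℕ} (hl : Odd l) :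
    ∫ z, (z.1 0) ^ l ∂(surfaceMeasure m) = 0 := by
  have h := integral_surfaceMeasure_comp_isometry (m := m) (LinearIsometryEquiv.neg ℝ)
    (fun z => (z 0) ^ l)
  simp [hl.neg_pow, integral_neg] at h
  linarith

theorem coeff_one_add_X_sq_pow (b : ℕ) :
    ((1 + X ^ 2 : ℝ[X]) ^ b).coeff 0 = 1 ∧ ((1 + X ^ 2 : ℝ[X]) ^ b).coeff 2 = b := by
  induction b with
  | zero => simp [coeff_one]
  | succ b ih =>
    rw [pow_succ, mul_add, mul_one]
    simp [coeff_mul_X_pow', ih.1, ih.2]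

theorem integral_surfaceMeasure_add_smul_pow {m : ℕ} {i : Fin (m + 2)} (hi : i ≠ 0) (s : ℝ)
    (b : ℕ) :
    ∫ z, (z.1 0 + s * z.1 i) ^ (2 * b) ∂(surfaceMeasure m) =
      (1 + s ^ 2) ^ b * ∫ z, (z.1 0) ^ (2 * b) ∂(surfaceMeasure m) := by
  let v : EuclideanSpace ℝ (Fin (m + 2)) :=
    EuclideanSpace.single 0 1 + s • EuclideanSpace.single i 1
  have hv : ‖v‖ ^ 2 = 1 + s ^ 2 := by
    rw [norm_add_sq_real]
    simp [inner_smul_right, norm_smul, hi.symm, EuclideanSpace.inner_single_left]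
  have hv0 : ‖v‖ ≠ 0 := by
    intro h
    rw [h] at hv
    nlinarith [sq_nonneg s]
  have h := integral_surfaceMeasure_inner (x := ‖v‖⁻¹ • v) (by simp [norm_smul, hv0])
    (fun t => t ^ (2 * b))
  rw [← h, ← hv, ← integral_const_mul]
  congr 1
  ext z
  rw [real_inner_smul_left, mul_pow, ← mul_assoc, inv_pow, ← pow_mul,
    mul_inv_cancel₀ (pow_ne_zero _ hv0), one_mul]
  simp [v, inner_add_left, inner_smul_left, EuclideanSpace.inner_single_left]

theorem integral_surfaceMeasure_pow_mul_sq {m : ℕ} {i : Fin (m + 2)} (hi : i ≠ 0) (b : ℕ) :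
    (2 * b + 1) * ∫ z, (z.1 0) ^ (2 * b) * (z.1 i) ^ 2 ∂(surfaceMeasure m) =
      ∫ z, (z.1 0) ^ (2 * b + 2) ∂(surfaceMeasure m) := by
  let A : ℕ → ℝ := fun l => ∫ z, (z.1 i) ^ l * (z.1 0) ^ (2 * (b + 1) - l) ∂(surfaceMeasure m)
  have key : (∑ l ∈ Finset.range (2 * (b + 1) + 1),
      C (A l * ((2 * (b + 1)).choose l : ℝ)) * X ^ l : ℝ[X]) =
      C (∫ z, (z.1 0) ^ (2 * (b + 1)) ∂(surfaceMeasure m)) * (1 + X ^ 2) ^ (b + 1) := by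
    refine Polynomial.funext fun s => ?_
    simp only [eval_mul, eval_C, eval_pow, eval_add, eval_one, eval_X, eval_finsetSum]
    rw [mul_comm (∫ _, _ ∂_), ← integral_surfaceMeasure_add_smul_pow hi]
    simp only [add_comm _ (s * _), add_pow, mul_pow]
    rw [integral_finsetSum]
    · refine Finset.sum_congr rfl fun l _ => ?_
      simp only [A, ← integral_mul_const]
      congr 1
      ext z
      ring
    · intro l _
      exact integrable_surfaceMeasure_of_continuous (by fun_prop)
  have h2 := congrArg (fun p => p.coeff 2) key
  simp only [finsetSum_coeff, coeff_C_mul, coeff_X_pow, (coeff_one_add_X_sq_pow _).2] at h2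
  simp only [mul_ite, mul_one, mul_zero] at h2
  rw [Finset.sum_ite_eq, if_pos (by simp), Nat.cast_choose_two] at h2
  simp only [A, mul_add, mul_one] at h2
  simp only [mul_comm (_ ^ 2 : ℝ)] at h2
  push_cast at h2
  have hb : (b : ℝ) + 1 ≠ 0 := by positivity
  apply mul_left_cancel₀ hb
  linarith

theorem integral_surfaceMeasure_recurrence {m : ℕ} (a : ℕ) :
    (a + (m + 2)) * ∫ z, (z.1 0) ^ (a + 2) ∂(surfaceMeasure m) =
      (a + 1) * ∫ z, (z.1 0) ^ a ∂(surfaceMeasure m) := by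
  rcases Nat.even_or_odd' a with ⟨b, rfl | rfl⟩
  · have h : ∫ z, (z.1 0) ^ (2 * b) ∂(surfaceMeasure m) =
        ∑ i, ∫ z, (z.1 0) ^ (2 * b) * (z.1 i) ^ 2 ∂(surfaceMeasure m) := by
      rw [← integral_finsetSum _ fun i _ => integrable_surfaceMeasure_of_continuous (by fun_prop)]
      congr 1
      ext z
      rw [← Finset.mul_sum]
      have := EuclideanSpace.real_norm_sq_eq z.1
      rw [← this]
      simp
    rw [h, Fin.sum_univ_succ, mul_add, Finset.mul_sum]
    push_cast
    simp only [integral_surfaceMeasure_pow_mul_sq (Fin.succ_ne_zero _)]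
    simp only [← pow_add]
    simp
    ring
  · rw [integral_surfaceMeasure_coord_pow_odd ⟨b, rfl⟩,
      integral_surfaceMeasure_coord_pow_odd ⟨b + 1, by ring⟩]
    simp

theorem intervalIntegrable_gegenbauerWeight (m : ℕ) :
    IntervalIntegrable (fun t : ℝ => (1 - t ^ 2) ^ ((((m + 2 : ℕ) : ℝ) - 3) / 2)) volume (-1) 1 := by
  rcases Nat.eq_zero_or_pos m with rfl | hm
  · refine Chebyshev.intervalIntegrable_sqrt_one_sub_sq_inv.congr fun t ht => ?_
    rw [Set.uIoc_of_le (by norm_num)] at ht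
    have h : 0 ≤ 1 - t ^ 2 := by nlinarith [ht.1, ht.2]
    rw [Real.sqrt_eq_rpow, Real.inv_rpow h, ← Real.rpow_neg h]
    norm_num
  · have h : (1 : ℝ) ≤ m := by exact_mod_cast hm
    refine Continuous.intervalIntegrable ?_ _ _
    refine Continuous.rpow_const (by fun_prop) fun t => Or.inr ?_
    push_cast
    linarith

/-- Integration of a polynomial over `[-1, 1]` against the weight `(1 - t²)^((n - 3) / 2)`,
where `n = m + 2`. -/
noncomputable def gegenbauerIntegral (m : ℕ) : ℝ[X] →ₗ[ℝ] ℝ where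
  toFun p := ∫ t in (-1 : ℝ)..1, p.eval t * (1 - t ^ 2) ^ ((((m + 2 : ℕ) : ℝ) - 3) / 2)
  map_add' p q := by
    simp only [eval_add, add_mul]
    exact intervalIntegral.integral_add
      ((intervalIntegrable_gegenbauerWeight m).continuousOn_mul p.continuous.continuousOn)
      ((intervalIntegrable_gegenbauerWeight m).continuousOn_mul q.continuous.continuousOn)
  map_smul' c p := by
    simp only [eval_smul, smul_eq_mul, mul_assoc, intervalIntegral.integral_const_mul,
      RingHom.id_apply]

theorem gegenbauerIntegral_apply (m : ℕ) (p : ℝ[X]) : gegenbauerIntegral m p =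
    ∫ t in (-1 : ℝ)..1, p.eval t * (1 - t ^ 2) ^ ((((m + 2 : ℕ) : ℝ) - 3) / 2) := rfl

theorem gegenbauerIntegral_derivative (m : ℕ) (p : ℝ[X]) :
    gegenbauerIntegral m (derivative p * (1 - X ^ 2) - ((m : ℝ) + 1) • (X * p)) = 0 := by
  have hα : (0 : ℝ) < (((m + 2 : ℕ) : ℝ) - 3) / 2 + 1 := by
    push_cast
    linarith [(m.cast_nonneg : (0 : ℝ) ≤ m)]
  rw [gegenbauerIntegral_apply]
  rw [intervalIntegral.integral_eq_sub_of_hasDerivAt_of_le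
    (f := fun t => p.eval t * (1 - t ^ 2) ^ ((((m + 2 : ℕ) : ℝ) - 3) / 2 + 1)) (by norm_num)]
  · norm_num only [one_pow, sub_self, even_two.neg_pow, Real.zero_rpow hα.ne', mul_zero]
  · refine (p.continuous.mul ?_).continuousOn
    exact Continuous.rpow_const (by fun_prop) fun t => Or.inr hα.le
  · intro t ht
    have h : 0 < 1 - t ^ 2 := by nlinarith [ht.1, ht.2]
    have h1 : HasDerivAt (fun t : ℝ => 1 - t ^ 2) (-(2 * t)) t := by
      simpa using (hasDerivAt_pow 2 t).const_sub 1
    have := (p.hasDerivAt t).mul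
      (h1.rpow_const (p := (((m + 2 : ℕ) : ℝ) - 3) / 2 + 1) (Or.inl h.ne'))
    refine this.congr_deriv ?_
    rw [Real.rpow_add_one h.ne', add_sub_cancel_right]
    simp only [eval_sub, eval_mul, eval_one, eval_pow, eval_X, eval_smul, smul_eq_mul]
    push_cast
    ring
  · exact (intervalIntegrable_gegenbauerWeight m).continuousOn_mul
      (Polynomial.continuous _).continuousOn

theorem gegenbauerIntegral_recurrence (m a : ℕ) :
    (a + (m + 2)) * gegenbauerIntegral m (X ^ (a + 2)) =
      (a + 1) * gegenbauerIntegral m (X ^ a) := by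
  have h := gegenbauerIntegral_derivative m (X ^ (a + 1))
  have e : derivative (X ^ (a + 1) : ℝ[X]) * (1 - X ^ 2) - ((m : ℝ) + 1) • (X * X ^ (a + 1)) =
      ((a : ℝ) + 1) • X ^ a - ((a : ℝ) + (m + 2)) • X ^ (a + 2) := by
    simp only [derivative_X_pow, smul_eq_C_mul]
    simp only [Nat.add_sub_cancel, map_add, map_natCast, map_one, map_ofNat, Nat.cast_add,
      Nat.cast_one]
    ring
  rw [e, map_sub, map_smul, map_smul, smul_eq_mul, smul_eq_mul] at h
  linarith

theorem gegenbauerIntegral_X (m : ℕ) : gegenbauerIntegral m X = 0 := by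
  have h := gegenbauerIntegral_derivative m 1
  simpa [neg_eq_zero, (by positivity : (m : ℝ) + 1 ≠ 0)] using h

theorem gegenbauerIntegral_sq_pos (m : ℕ) {p : ℝ[X]} (hp : p ≠ 0) :
    0 < gegenbauerIntegral m (p * p) := by
  have hnn : ∀ t ∈ Set.Ioc (-1 : ℝ) 1,
      0 ≤ (p * p).eval t * (1 - t ^ 2) ^ ((((m + 2 : ℕ) : ℝ) - 3) / 2) := by
    intro t ht
    rw [eval_mul]
    exact mul_nonneg (mul_self_nonneg _) (Real.rpow_nonneg (by nlinarith [ht.1, ht.2]) _)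
  rw [gegenbauerIntegral_apply, intervalIntegral.integral_of_le (by norm_num),
    setIntegral_pos_iff_support_of_nonneg_ae]
  · have hsub : Set.Ioo (-1 : ℝ) 1 \ p.rootSet ℝ ⊆
        (Function.support fun t : ℝ =>
          (p * p).eval t * (1 - t ^ 2) ^ ((((m + 2 : ℕ) : ℝ) - 3) / 2)) ∩ Set.Ioc (-1) 1 := by
      rintro t ⟨ht, hr⟩
      refine ⟨?_, Set.Ioo_subset_Ioc_self ht⟩
      have h : 0 < 1 - t ^ 2 := by nlinarith [ht.1, ht.2]
      have hr' : p.eval t ≠ 0 := by simpa [mem_rootSet, hp] using hr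
      rw [Function.mem_support, eval_mul]
      exact mul_ne_zero (mul_ne_zero hr' hr') (Real.rpow_pos_of_pos h _).ne'
    refine lt_of_lt_of_le ?_ (measure_mono hsub)
    rw [measure_sdiff_null ((p.rootSet_finite ℝ).measure_zero _)]
    simp
  · filter_upwards [ae_restrict_mem measurableSet_Ioc] with t ht using hnn t ht
  · rw [← intervalIntegrable_iff_integrableOn_Ioc_of_le (by norm_num)]
    exact (intervalIntegrable_gegenbauerWeight m).continuousOn_mul
      (Polynomial.continuous _).continuousOn

theorem gegenbauerIntegral_one_mul_integral_surfaceMeasure (m : ℕ) (p : ℝ[X]) :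
    gegenbauerIntegral m 1 * ∫ z, p.eval (z.1 0) ∂(surfaceMeasure m) =
      (surfaceMeasure m).real Set.univ * gegenbauerIntegral m p := by
  induction p using Polynomial.induction_on' with
  | add p q hp hq =>
    simp only [eval_add]
    rw [integral_add (integrable_surfaceMeasure_of_continuous (by fun_prop))
      (integrable_surfaceMeasure_of_continuous (by fun_prop)), map_add, mul_add, mul_add, hp, hq]
  | monomial a c =>
    have key : gegenbauerIntegral m 1 * ∫ z, (z.1 0) ^ a ∂(surfaceMeasure m) =
        (surfaceMeasure m).real Set.univ * gegenbauerIntegral m (X ^ a) := by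
      induction a using Nat.twoStepInduction with
      | zero => simp [mul_comm]
      | one =>
        rw [integral_surfaceMeasure_coord_pow_odd odd_one, pow_one, gegenbauerIntegral_X]
        simp
      | more a ih _ =>
        have ha : (a : ℝ) + (m + 2) ≠ 0 := by positivity
        apply mul_left_cancel₀ ha
        rw [mul_left_comm, integral_surfaceMeasure_recurrence, mul_left_comm, ih, mul_left_comm _ _
          (gegenbauerIntegral m (X ^ (a + 2))), gegenbauerIntegral_recurrence]
        ring
    simp only [eval_monomial, integral_const_mul]
    rw [← C_mul_X_pow_eq_monomial, ← smul_eq_C_mul, map_smul, smul_eq_mul, mul_left_comm, key]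
    ring

/-- Averaging a polynomial in `⟪y, z⟫` against a function of `⟪x, z⟫` over the sphere yields a
polynomial in `⟪x, y⟫` of no larger degree. -/
theorem exists_polynomial_integral_surfaceMeasure (m : ℕ) (p q : ℝ[X]) :
    ∃ f : ℝ[X], f.degree ≤ q.degree ∧ ∀ x y : EuclideanSpace ℝ (Fin (m + 2)),
      ‖x‖ = 1 → ‖y‖ = 1 → ∫ z, p.eval ⟪x, z.1⟫ * q.eval ⟪y, z.1⟫ ∂(surfaceMeasure m) =
        f.eval ⟪x, y⟫ := by
  have mono : ∀ j : ℕ, ∃ f : ℝ[X], f.degree ≤ j ∧ ∀ x y : EuclideanSpace ℝ (Fin (m + 2)),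
      ‖x‖ = 1 → ‖y‖ = 1 → ∫ z, p.eval ⟪x, z.1⟫ * ⟪y, z.1⟫ ^ j ∂(surfaceMeasure m) =
        f.eval ⟪x, y⟫ := by
    intro j
    let A : ℕ → ℝ := fun l =>
      ∫ z, (p * X ^ (j - l)).eval (z.1 0) * (z.1 1) ^ l ∂(surfaceMeasure m)
    refine ⟨∑ l ∈ Finset.range (j + 1),
      C (A l * (j.choose l : ℝ)) * (X ^ (j - l) * (1 - X ^ 2) ^ (l / 2)), ?_, ?_⟩
    · refine mem_degreeLE.1 (Submodule.sum_mem _ fun l hl => mem_degreeLE.2 ?_)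
      have hl' : l ≤ j := by simpa [Nat.lt_succ_iff] using hl
      rw [← natDegree_le_iff_degree_le]
      refine (natDegree_C_mul_le _ _).trans (natDegree_mul_le.trans ?_)
      have h2 : ((1 - X ^ 2 : ℝ[X]) ^ (l / 2)).natDegree ≤ l / 2 * 2 := by
        refine natDegree_pow_le_of_le _ ?_
        exact (natDegree_sub_le _ _).trans (by simp)
      rw [natDegree_X_pow]
      omega
    · intro x y hx hy
      obtain ⟨b, s, hb, hs, hy'⟩ := exists_orthonormalBasis_adapted hx hy
      have hG := integral_surfaceMeasure_orthonormalBasis b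
        fun u v => p.eval u * (s * v + ⟪x, y⟫ * u) ^ j
      have hl : ∀ z : EuclideanSpace ℝ (Fin (m + 2)),
          ⟪y, z⟫ = s * ⟪b 1, z⟫ + ⟪x, y⟫ * ⟪x, z⟫ := by
        intro z
        conv_lhs => rw [hy']
        rw [inner_add_left, real_inner_smul_left, real_inner_smul_left, add_comm]
      simp only [hb, ← hl] at hG
      rw [hG]
      simp only [add_pow, Finset.mul_sum, eval_finsetSum]
      rw [integral_finsetSum _ fun l _ => integrable_surfaceMeasure_of_continuous (by fun_prop)]
      refine Finset.sum_congr rfl fun l _ => ?_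
      have e : ∫ z, p.eval (z.1 0) * ((s * z.1 1) ^ l * (⟪x, y⟫ * z.1 0) ^ (j - l) *
          (j.choose l : ℝ)) ∂(surfaceMeasure m) =
          A l * (s ^ l * ⟪x, y⟫ ^ (j - l) * (j.choose l : ℝ)) := by
        simp only [A, ← integral_mul_const]
        congr 1
        ext z
        simp only [eval_mul, eval_pow, eval_X]
        ring
      rw [e]
      simp only [eval_mul, eval_C, eval_pow, eval_X, eval_sub, eval_one, ← hs]
      rcases Nat.even_or_odd l with h | h
      · rw [← pow_mul, Nat.mul_div_cancel' h.two_dvd]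
        ring
      · simp only [A, integral_surfaceMeasure_odd (fun u => (p * X ^ (j - l)).eval u) h]
        ring
  choose f hf hint using mono
  refine ⟨∑ j ∈ q.support, C (q.coeff j) * f j, ?_, ?_⟩
  · refine mem_degreeLE.1 (Submodule.sum_mem _ fun j hj => mem_degreeLE.2 ?_)
    rw [← smul_eq_C_mul]
    exact (degree_smul_le _ _).trans ((hf j).trans (le_degree_of_mem_supp j hj))
  · intro x y hx hy
    simp only [q.eval_eq_sum, Polynomial.sum, Finset.mul_sum, eval_finsetSum]
    rw [integral_finsetSum _ fun l _ => integrable_surfaceMeasure_of_continuous (by fun_prop)]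
    refine Finset.sum_congr rfl fun j _ => ?_
    rw [eval_mul, eval_C, ← hint j x y hx hy, ← integral_const_mul]
    congr 1
    ext z
    ring

theorem exists_degree_sub_smul_lt {p q : ℝ[X]} {d : ℕ} (hp : p.degree = d) (hq : q.degree ≤ d) :
    ∃ c : ℝ, (q - c • p).degree < d := by
  have hc : p.coeff d ≠ 0 := coeff_ne_zero_of_eq_degree hp
  refine ⟨q.coeff d / p.coeff d, ?_⟩
  rw [degree_lt_iff_coeff_zero]
  intro i hi
  rcases hi.eq_or_lt with rfl | hi
  · simp [hc]
  · have hdi : (d : WithBot ℕ) < i := by exact_mod_cast hi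
    rw [coeff_sub, coeff_smul, coeff_eq_zero_of_degree_lt (hq.trans_lt hdi),
      coeff_eq_zero_of_degree_lt (hp.trans_lt hdi)]
    simp

/-- Orthogonality to `p 0, …, p (k - 1)` implies orthogonality to all polynomials of degree less
than `k`, when each `p l` has degree `l`. -/
theorem map_mul_eq_zero_of_degree_lt {L : ℝ[X] →ₗ[ℝ] ℝ} {p : ℕ → ℝ[X]}
    (hdeg : ∀ k, (p k).degree = k) {k : ℕ} {f q : ℝ[X]} (hf : ∀ l < k, L (f * p l) = 0)
    (hq : q.degree < k) : L (f * q) = 0 := by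
  induction k generalizing q with
  | zero =>
    have : q = 0 := by simpa using hq
    simp [this]
  | succ d ih =>
    obtain ⟨c, hc⟩ := exists_degree_sub_smul_lt (hdeg d) (q := q) <|
      (degree_le_iff_coeff_zero _ _).2 fun i hi =>
        (degree_lt_iff_coeff_zero _ _).1 hq i (by exact_mod_cast hi)
    have h := ih (fun l hl => hf l (hl.trans d.lt_succ_self)) hc
    rw [mul_sub, mul_smul_comm, map_sub, map_smul, hf d d.lt_succ_self] at h
    simpa using h

/-- The kernel `p k ⟪x, y⟫` is, up to a positive factor, reproduced by averaging over the sphere. -/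
theorem exists_pos_integral_surfaceMeasure_eq {m : ℕ} {p : ℕ → ℝ[X]}
    (hdeg : ∀ k, (p k).degree = k)
    (horth : ∀ k l, k ≠ l → gegenbauerIntegral m (p k * p l) = 0)
    (hone : ∀ k, (p k).eval 1 = 1) (k : ℕ) :
    ∃ c : ℝ, 0 < c ∧ ∀ x y : EuclideanSpace ℝ (Fin (m + 2)), ‖x‖ = 1 → ‖y‖ = 1 →
      ∫ z, (p k).eval ⟪x, z.1⟫ * (p k).eval ⟪y, z.1⟫ ∂(surfaceMeasure m) =
        c * (p k).eval ⟪x, y⟫ := by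
  obtain ⟨f, hf, hint⟩ := exists_polynomial_integral_surfaceMeasure m (p k) (p k)
  have hW : 0 < gegenbauerIntegral m 1 := by
    simpa using gegenbauerIntegral_sq_pos m (one_ne_zero : (1 : ℝ[X]) ≠ 0)
  have hσ : 0 < (surfaceMeasure m).real Set.univ := by
    rw [Measure.real, ENNReal.toReal_pos_iff]
    exact ⟨by simp [measure_ball_pos], measure_lt_top _ _⟩
  have hzero : ∀ (x : EuclideanSpace ℝ (Fin (m + 2))) (q : ℝ[X]), ‖x‖ = 1 →
      gegenbauerIntegral m q = 0 → ∫ z, q.eval ⟪x, z.1⟫ ∂(surfaceMeasure m) = 0 := by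
    intro x q hx hq
    have h := gegenbauerIntegral_one_mul_integral_surfaceMeasure m q
    rw [hq, mul_zero] at h
    rw [integral_surfaceMeasure_inner hx fun t => q.eval t]
    exact (mul_eq_zero.1 h).resolve_left hW.ne'
  have hnorm : ∀ z : sphere (0 : EuclideanSpace ℝ (Fin (m + 2))) 1, ‖z.1‖ = 1 := fun z => by simp
  let e : EuclideanSpace ℝ (Fin (m + 2)) := EuclideanSpace.single 0 1
  have he : ‖e‖ = 1 := by simp [e]
  have horthf : ∀ l < k, gegenbauerIntegral m (f * p l) = 0 := by
    intro l hl
    obtain ⟨g, hg, hgint⟩ := exists_polynomial_integral_surfaceMeasure m (p k) (p l)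
    have h1 : ∫ y, (f * p l).eval ⟪e, y.1⟫ ∂(surfaceMeasure m) = 0 := by
      calc ∫ y, (f * p l).eval ⟪e, y.1⟫ ∂(surfaceMeasure m)
          = ∫ y, ∫ z, (p k).eval ⟪e, z.1⟫ * (p k).eval ⟪y.1, z.1⟫ * (p l).eval ⟪e, y.1⟫
              ∂(surfaceMeasure m) ∂(surfaceMeasure m) := by
            congr 1
            ext y
            rw [eval_mul, ← hint e y he (hnorm y), integral_mul_const]
        _ = ∫ z, ∫ y, (p k).eval ⟪e, z.1⟫ * (p k).eval ⟪y.1, z.1⟫ * (p l).eval ⟪e, y.1⟫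
              ∂(surfaceMeasure m) ∂(surfaceMeasure m) := by
            refine integral_integral_swap (Continuous.integrable_of_hasCompactSupport ?_
              (HasCompactSupport.of_compactSpace _))
            simp only [Function.uncurry_def]
            fun_prop
        _ = ∫ z, (p k * g).eval ⟪e, z.1⟫ ∂(surfaceMeasure m) := by
            congr 1
            ext z
            rw [eval_mul, real_inner_comm, ← hgint z e (hnorm z) he, ← integral_const_mul]
            congr 1
            ext y
            rw [real_inner_comm y.1 z.1, mul_assoc, real_inner_comm e z.1]
        _ = 0 := by
            refine hzero e _ he (map_mul_eq_zero_of_degree_lt hdeg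
              (fun j hj => horth k j hj.ne') ?_)
            exact hg.trans_lt (by rw [hdeg]; exact_mod_cast hl)
    have h2 := gegenbauerIntegral_one_mul_integral_surfaceMeasure m (f * p l)
    rw [← integral_surfaceMeasure_inner he fun t => (f * p l).eval t, h1, mul_zero] at h2
    exact (mul_eq_zero.1 h2.symm).resolve_left hσ.ne'
  obtain ⟨c, hc⟩ := exists_degree_sub_smul_lt (hdeg k) (hf.trans_eq (hdeg k))
  have hfc : f = c • p k := by
    by_contra hne
    refine (gegenbauerIntegral_sq_pos m (sub_ne_zero.2 hne)).ne'
      (map_mul_eq_zero_of_degree_lt hdeg (fun l hl => ?_) hc)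
    rw [sub_mul, smul_mul_assoc, map_sub, map_smul, horthf l hl, horth k l hl.ne']
    simp
  refine ⟨c, ?_, fun x y hx hy => by rw [hint x y hx hy, hfc, eval_smul, smul_eq_mul]⟩
  have hce : c = ∫ z, (p k * p k).eval ⟪e, z.1⟫ ∂(surfaceMeasure m) := by
    simp only [eval_mul]
    rw [hint e e he he, hfc, eval_smul, real_inner_self_eq_norm_sq, he, one_pow, hone, smul_eq_mul,
      mul_one]
  have h := gegenbauerIntegral_one_mul_integral_surfaceMeasure m (p k * p k)
  rw [← integral_surfaceMeasure_inner he fun t => (p k * p k).eval t, ← hce] at h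
  have hp : p k ≠ 0 := fun h0 => by simpa [h0] using hone k
  exact pos_of_mul_pos_right (h ▸ mul_pos hσ (gegenbauerIntegral_sq_pos m hp)) hW.le

/-- Positive-definiteness of the Gegenbauer polynomials (Schoenberg's theorem, finite
form): for any finite set of unit vectors `x_1, …, x_N` in `ℝ^n` and any `k`, the sum
`∑_{i,j} P_k^n(x_i · x_j)` is nonnegative.  The family `P k` is characterized by:
`P k` is a polynomial of degree `k`, the family is orthogonal on `[-1,1]` with
respect to the weight `(1-t²)^((n-3)/2)`, and `P k 1 = 1`. -/
theorem stmt12 (n : ℕ) (hn : 2 ≤ n) (P : ℕ → ℝ → ℝ)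
    (hdeg : ∀ k, ∃ p : Polynomial ℝ, p.natDegree = k ∧ ∀ t, P k t = p.eval t)
    (horth : ∀ k l, k ≠ l →
      ∫ t in (-1 : ℝ)..1, P k t * P l t * (1 - t ^ 2) ^ (((n : ℝ) - 3) / 2) = 0)
    (hnorm : ∀ k, P k 1 = 1)
    (N : ℕ) (x : Fin N → EuclideanSpace ℝ (Fin n)) (hx : ∀ i, ‖x i‖ = 1)
    (k : ℕ) :
    0 ≤ ∑ i : Fin N, ∑ j : Fin N, P k ⟪x i, x j⟫ := by
  obtain ⟨m, rfl⟩ := Nat.exists_eq_add_of_le' hn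
  choose p hp hP using hdeg
  simp only [hP] at horth hnorm ⊢
  have hdeg' : ∀ k, (p k).degree = k := fun k => by
    rw [degree_eq_natDegree fun h0 => by simpa [h0] using hnorm k, hp]
  obtain ⟨c, hc, hint⟩ := exists_pos_integral_surfaceMeasure_eq (m := m) hdeg'
    (fun k l hkl => by simpa only [gegenbauerIntegral_apply, eval_mul] using horth k l hkl) hnorm k
  refine (mul_nonneg_iff_of_pos_left hc).1 ?_
  calc (0 : ℝ) ≤ ∫ z, (∑ i, (p k).eval ⟪x i, z.1⟫) * (∑ j, (p k).eval ⟪x j, z.1⟫)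
        ∂(surfaceMeasure m) := integral_nonneg fun z => mul_self_nonneg _
    _ = c * ∑ i, ∑ j, (p k).eval ⟪x i, x j⟫ := by
      simp only [Finset.sum_mul_sum]
      simp only [Finset.mul_sum]
      rw [integral_finsetSum _ fun i _ => integrable_surfaceMeasure_of_continuous (by fun_prop)]
      refine Finset.sum_congr rfl fun i _ => ?_
      rw [integral_finsetSum _ fun j _ => integrable_surfaceMeasure_of_continuous (by fun_prop)]
      exact Finset.sum_congr rfl fun j _ => hint _ _ (hx i) (hx j)
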